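/- Let (Ω, X_n, ℙ_x) be a Markov chain on a nonempty finite set V, and let ∅ ≠ V_1 ⊊ V_2 ⊊ ⋯ ⊊ V_m = V be a strictly increasing sequence of subsets with #(V_j ∖ V_{j-1}) = 1 for every 2 ≤ j ≤ m. Then for any A ⊆ V and x ∈ V with ℙ_x(τ_A < ∞) = 1 and every finite path w on V, ℙ_x(𝔏(X|_{[0,τ_A]}) = w) = ℙ_x(𝔏_{V_m} ∘ ⋯ ∘ 𝔏_{V_2} ∘ 𝔏_{V_1}(X|_{[0,τ_A]}) = w). -/

import Mathlib

open MeasureTheory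

namespace LERW

variable {V : Type*} [DecidableEq V]

/-- The suffix of `l` strictly after the last occurrence of `a` in `l`
(`l` itself if `a` does not occur in `l`). -/
def dropToLastOcc (a : V) (l : List V) : List V :=
  (l.reverse.takeWhile (fun z => z ≠ a)).reverse

lemma dropToLastOcc_length_le (a : V) (l : List V) :
    (dropToLastOcc a l).length ≤ l.length := by
  unfold dropToLastOcc
  calc ((l.reverse.takeWhile (fun z => z ≠ a)).reverse).length
      = (l.reverse.takeWhile (fun z => z ≠ a)).length := by simp
    _ ≤ l.reverse.length := (List.takeWhile_sublist _).length_le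
    _ = l.length := by simp

/-- Partial loop erasure `𝔏_S` of a finite path, associated with a set `S` of vertices. -/
def PLE (S : Finset V) : List V → List V
  | [] => []
  | a :: rest =>
    if a ∈ S then
      if a = (a :: rest).getLast (List.cons_ne_nil a rest) then [a]
      else a :: PLE S (dropToLastOcc a rest)
    else
      if rest = [] then [a]
      else a :: PLE S rest
termination_by l => l.length
decreasing_by
  · simpa using Nat.lt_succ_of_le (dropToLastOcc_length_le a rest)
  · simp

variable [Fintype V]

/-- The (full) loop erasure `𝔏 = 𝔏_V`. -/
def LE : List V → List V := PLE Finset.univ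

/-- Iterated partial loop erasure `𝔏_{W m} ∘ ⋯ ∘ 𝔏_{W 2} ∘ 𝔏_{W 1}`. -/
def iterPLE (W : ℕ → Finset V) : ℕ → List V → List V
  | 0, l => l
  | n + 1, l => PLE (W (n + 1)) (iterPLE W n l)

/-- The remaining suffix `w|_{[n_j , η]}` of the loop-erasing walk of `𝔏` the first time
its current value equals `b` (`[]` if this never happens). -/
def LEsuffixAt (b : V) : List V → List V
  | [] => []
  | a :: rest =>
    if a = b then a :: rest
    else if a = (a :: rest).getLast (List.cons_ne_nil a rest) then []
    else LEsuffixAt b (dropToLastOcc a rest)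
termination_by l => l.length
decreasing_by
  simpa using Nat.lt_succ_of_le (dropToLastOcc_length_le a rest)

/-- Entry time `τ_A` into `A ⊆ V`, valued in `ℕ∞`. -/
noncomputable def entryTime (A : Finset V) (ω : ℕ → V) : ℕ∞ :=
  sInf {m : ℕ∞ | ∃ n : ℕ, m = (n : ℕ∞) ∧ ω n ∈ A}

/-- Entry time `τ_A` as a natural number (junk value `0` when `A` is never visited). -/
noncomputable def entryTimeNat (A : Finset V) (ω : ℕ → V) : ℕ :=
  sInf {n : ℕ | ω n ∈ A}

/-- The random finite path `X|_{[0, τ_A]} = (X_0, X_1, …, X_{τ_A})`. -/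
noncomputable def stoppedPath (A : Finset V) (ω : ℕ → V) : List V :=
  (List.range (entryTimeNat A ω + 1)).map ω

/-- Iterated hitting times `τ̊_W^{(n)}` of `W`, valued in `ℕ∞` (with the convention
`τ̊_W^{(0)} = 0`). -/
noncomputable def iterHit (W : Finset V) (ω : ℕ → V) : ℕ → ℕ∞
  | 0 => 0
  | n + 1 => sInf {m : ℕ∞ | ∃ k : ℕ, m = (k : ℕ∞) ∧ iterHit W ω n < (k : ℕ∞) ∧ ω k ∈ W}

/-- The time `τ̊_W^{(n)} ∧ τ_A`, as a natural number. -/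
noncomputable def traceTime (W A : Finset V) (ω : ℕ → V) (n : ℕ) : ℕ :=
  (iterHit W ω n ⊓ entryTime A ω).toNat

variable [MeasurableSpace V]

/-- The trace process `X̃_n = X_{τ̊_W^{(n)} ∧ τ_A}` (so `X̃_0 = X_0`). -/
noncomputable def traceProc (W A : Finset V) (ω : ℕ → V) (n : ℕ) : V :=
  ω (traceTime W A ω n)

/-- The Green function `G_B(x, y) = 𝔼_x(#{0 ≤ n < τ_{V∖B} : X_n = y})`. -/
noncomputable def green (μ : V → Measure (ℕ → V)) (B : Finset V) (x y : V) : ℝ :=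
  ∑' n : ℕ, (μ x {ω | ω n = y ∧ ∀ k ≤ n, ω k ∈ B}).toReal

section Aux

set_option linter.unusedSectionVars false

open scoped ENNReal
open Classical in
/-- indicator of a proposition -/
noncomputable def iv (p : Prop) : ℝ≥0∞ := if p then 1 else 0

lemma iv_true {p : Prop} (h : p) : iv p = 1 := by simp [iv, h]
lemma iv_false {p : Prop} (h : ¬ p) : iv p = 0 := by simp [iv, h]
lemma iv_and (p q : Prop) : iv (p ∧ q) = iv p * iv q := by
  by_cases hp : p <;> by_cases hq : q <;> simp [iv, hp, hq]
lemma iv_congr {p q : Prop} (h : p ↔ q) : iv p = iv q := by rw [propext h]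
lemma iv_mul_congr {p : Prop} {x y : ℝ≥0∞} (h : p → x = y) : iv p * x = iv p * y := by
  by_cases hp : p
  · rw [h hp]
  · simp [iv_false hp]
lemma iv_split (p : Prop) (x : ℝ≥0∞) : x = iv (¬ p) * x + iv p * x := by
  by_cases hp : p <;> simp [iv, hp]

lemma tsum_iv_single {κ : Type*} (k : κ) (f : κ → ℝ≥0∞) :
    ∑' j, iv (j = k) * f j = f k := by
  rw [tsum_eq_single k]
  · simp [iv]
  · intro j hj; simp [iv, hj]

lemma tsum_iv_single' {κ : Type*} (k : κ) (f : κ → ℝ≥0∞) :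
    ∑' j, iv (k = j) * f j = f k := by
  rw [← tsum_iv_single k f]
  exact tsum_congr fun j => by rw [iv_congr eq_comm]

lemma tsum_reindex {ι κ : Type*} (h : ι → κ) (Q : ι → Prop) (R : κ → Prop) (f : κ → ℝ≥0∞)
    (h1 : ∀ i, Q i → R (h i)) (h2 : ∀ k, R k → ∃ i, Q i ∧ h i = k)
    (h3 : ∀ i j, Q i → Q j → h i = h j → i = j) :
    ∑' i, iv (Q i) * f (h i) = ∑' k, iv (R k) * f k := by
  have e1 : ∀ i, iv (Q i) * f (h i) = ∑' k, iv (Q i) * (iv (k = h i) * f k) := by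
    intro i; rw [ENNReal.tsum_mul_left, tsum_iv_single]
  rw [tsum_congr e1, ENNReal.tsum_comm]
  refine tsum_congr fun k => ?_
  by_cases hk : R k
  · obtain ⟨i, hi, rfl⟩ := h2 k hk
    rw [tsum_eq_single i]
    · simp [iv, hi, hk]
    · intro j hj
      by_cases hq : Q j
      · have : ¬ (h i = h j) := fun e => hj (h3 i j hi hq e).symm
        simp [iv, this]
      · simp [iv, hq]
  · rw [iv_false hk, zero_mul, ENNReal.tsum_eq_zero]
    intro i
    by_cases hq : Q i
    · have : ¬ (k = h i) := by rintro rfl; exact hk (h1 i hq)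
      simp [iv, this]
    · simp [iv, hq]

variable {U : Type*} [DecidableEq U]

lemma last_split (b : U) (l : List U) (hb : b ∈ l) : ∃ s t, l = s ++ b :: t ∧ b ∉ t := by
  induction l with
  | nil => simp at hb
  | cons a l ih =>
    by_cases h : b ∈ l
    · obtain ⟨s, t, rfl, ht⟩ := ih h
      exact ⟨a :: s, t, rfl, ht⟩
    · have : b = a := by simpa [h] using hb
      exact ⟨[], l, by simp [this], h⟩

lemma first_unique (b : U) : ∀ (s t s' t' : List U), b ∉ s → b ∉ s' →
    s ++ b :: t = s' ++ b :: t' → s = s' ∧ t = t'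
  | [], t, [], t', _, _, h => by simpa using h
  | [], t, c :: s', t', _, h', h => by simp at h h'; exact absurd h.1 h'.1
  | c :: s, t, [], t', h', _, h => by simp at h h'; exact absurd h.1.symm h'.1
  | c :: s, t, d :: s', t', h1, h2, h => by
    simp at h h1 h2
    obtain ⟨e1, e2⟩ := first_unique b s t s' t' h1.2 h2.2 h.2
    simp [e1, e2, h.1]

lemma last_unique (b : U) (s t s' t' : List U) (h : b ∉ t) (h' : b ∉ t')
    (e : s ++ b :: t = s' ++ b :: t') : s = s' ∧ t = t' := by
  have := first_unique b t.reverse s.reverse t'.reverse s'.reverse (by simpa) (by simpa)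
    (by simpa using congrArg List.reverse e)
  simpa [and_comm] using this

lemma tsum_first (b : U) (f : List U → ℝ≥0∞) :
    ∑' l, f l = ∑' l, iv (b ∉ l) * f l + ∑' s, ∑' t, iv (b ∉ s) * f (s ++ b :: t) := by
  rw [tsum_congr fun l => iv_split (b ∈ l) (f l), ENNReal.tsum_add]
  congr 1
  rw [← ENNReal.tsum_prod (f := fun s t => iv (b ∉ s) * f (s ++ b :: t))]
  symm
  apply tsum_reindex (fun q : List U × List U => q.1 ++ b :: q.2) (fun q => b ∉ q.1)
  · simp
  · intro l hl
    obtain ⟨s, t, e, hs⟩ := List.eq_append_cons_of_mem hl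
    exact ⟨(s, t), hs, e.symm⟩
  · rintro ⟨s, t⟩ ⟨s', t'⟩ h h' e
    have := first_unique b s t s' t' h h' e
    simp [this.1, this.2]

lemma tsum_last (b : U) (f : List U → ℝ≥0∞) :
    ∑' l, f l = ∑' l, iv (b ∉ l) * f l + ∑' s, ∑' t, iv (b ∉ t) * f (s ++ b :: t) := by
  rw [tsum_congr fun l => iv_split (b ∈ l) (f l), ENNReal.tsum_add]
  congr 1
  rw [← ENNReal.tsum_prod (f := fun s t => iv (b ∉ t) * f (s ++ b :: t))]
  symm
  apply tsum_reindex (fun q : List U × List U => q.1 ++ b :: q.2) (fun q => b ∉ q.2)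
  · simp
  · intro l hl
    obtain ⟨s, t, e, hs⟩ := last_split b l hl
    exact ⟨(s, t), hs, e.symm⟩
  · rintro ⟨s, t⟩ ⟨s', t'⟩ h h' e
    have := last_unique b s t s' t' h h' e
    simp [this.1, this.2]

/-- weight of a path -/
noncomputable def wt (p : U → U → ℝ≥0∞) : List U → ℝ≥0∞
  | [] => 1
  | [_] => 1
  | a :: b :: t => p a b * wt p (b :: t)

lemma wt_append (p : U → U → ℝ≥0∞) (b : U) (t : List U) : ∀ s : List U,
    wt p (s ++ b :: t) = wt p (s ++ [b]) * wt p (b :: t)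
  | [] => by simp [wt]
  | [a] => by simp [wt]
  | a :: c :: s => by
    have := wt_append p b t (c :: s)
    simp only [List.cons_append, wt] at this ⊢
    rw [this, mul_assoc]

/-- all elements avoid D -/
def av (D : Finset U) (l : List U) : Prop := ∀ x ∈ l, x ∉ D

@[simp] lemma av_nil (D : Finset U) : av D [] := by simp [av]
@[simp] lemma av_cons (D : Finset U) (a : U) (l : List U) :
    av D (a :: l) ↔ a ∉ D ∧ av D l := by simp [av]
@[simp] lemma av_append (D : Finset U) (s t : List U) :
    av D (s ++ t) ↔ av D s ∧ av D t := by
  simp only [av, List.mem_append]; constructor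
  · intro h; exact ⟨fun x hx => h x (Or.inl hx), fun x hx => h x (Or.inr hx)⟩
  · rintro ⟨h1, h2⟩ x (hx | hx); exacts [h1 x hx, h2 x hx]
lemma av_insert (D : Finset U) (a : U) (l : List U) :
    av (insert a D) l ↔ a ∉ l ∧ av D l := by
  simp only [av, Finset.mem_insert, not_or]
  constructor
  · intro h; exact ⟨fun ha => (h a ha).1 rfl, fun x hx => (h x hx).2⟩
  · rintro ⟨h1, h2⟩ x hx; exact ⟨fun e => h1 (e ▸ hx), h2 x hx⟩

/-- positive-length paths with interior avoiding D -/
noncomputable def K (p : U → U → ℝ≥0∞) (D : Finset U) (x y : U) : ℝ≥0∞ :=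
  ∑' m : List U, iv (av D m) * wt p (x :: (m ++ [y]))

lemma wt_mid (p : U → U → ℝ≥0∞) (x b : U) (s t : List U) :
    wt p (x :: (s ++ b :: t)) = wt p (x :: (s ++ [b])) * wt p (b :: t) :=
  wt_append p b t (x :: s)

lemma K_first (p : U → U → ℝ≥0∞) (D : Finset U) (x y b : U) (hb : b ∉ D) :
    K p D x y = K p (insert b D) x y + K p (insert b D) x b * K p D b y := by
  unfold K
  rw [tsum_first b]
  congr 1
  · refine tsum_congr fun l => ?_
    rw [iv_congr (av_insert D b l), iv_and, mul_assoc]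
  · rw [← ENNReal.tsum_mul_right]
    refine tsum_congr fun s => ?_
    rw [← ENNReal.tsum_mul_left]
    refine tsum_congr fun t => ?_
    rw [iv_congr (av_insert D b s), iv_and, iv_congr (av_append D s (b :: t)), iv_and,
      iv_congr (av_cons D b t), iv_and, iv_true hb, List.append_assoc, List.cons_append, wt_mid]
    ring

lemma K_last (p : U → U → ℝ≥0∞) (D : Finset U) (x y b : U) (hb : b ∉ D) :
    K p D x y = K p (insert b D) x y + K p D x b * K p (insert b D) b y := by
  unfold K
  rw [tsum_last b]
  congr 1
  · refine tsum_congr fun l => ?_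
    rw [iv_congr (av_insert D b l), iv_and, mul_assoc]
  · rw [← ENNReal.tsum_mul_right]
    refine tsum_congr fun s => ?_
    rw [← ENNReal.tsum_mul_left]
    refine tsum_congr fun t => ?_
    rw [iv_congr (av_insert D b t), iv_and, iv_congr (av_append D s (b :: t)), iv_and,
      iv_congr (av_cons D b t), iv_and, iv_true hb, List.append_assoc, List.cons_append, wt_mid]
    ring

/-- Green function at the diagonal -/
noncomputable def Gd (p : U → U → ℝ≥0∞) (D : Finset U) (a : U) : ℝ≥0∞ := 1 + K p D a a

lemma Gd_eq (p : U → U → ℝ≥0∞) (D : Finset U) (a b : U) (ha : a ∉ D) (hb : b ∉ D) (hab : a ≠ b) :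
    Gd p D a = Gd p (insert b D) a + Gd p (insert b D) a * K p (insert a (insert b D)) a b *
      Gd p D b * K p (insert a (insert b D)) b a * Gd p (insert b D) a := by
  have h1 := K_first p D a a b hb
  have ha' : a ∉ insert b D := by simp [ha, hab]
  have h2 := K_last p (insert b D) a b a ha'
  have h3 := K_last p D b a b hb
  have h4 := K_first p (insert b D) b a a ha'
  unfold Gd
  rw [h1, h3, h2, h4]
  ring

lemma Gd_swap (p : U → U → ℝ≥0∞) (D : Finset U) (a b : U) (ha : a ∉ D) (hb : b ∉ D) :
    Gd p D a * Gd p (insert a D) b = Gd p D b * Gd p (insert b D) a := by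
  by_cases hab : a = b
  · subst hab; rfl
  have e1 := Gd_eq p D a b ha hb hab
  have e2 := Gd_eq p D b a hb ha (Ne.symm hab)
  rw [Finset.insert_comm b a] at e2
  set g := Gd p (insert b D) a
  set h := Gd p (insert a D) b
  set r := K p (insert a (insert b D)) a b
  set s := K p (insert a (insert b D)) b a
  set X := Gd p D a
  set Y := Gd p D b
  have f1 : X * h = g * h + g * h * r * s * (Y * g) := by rw [e1]; ring
  have f2 : Y * g = g * h + g * h * r * s * (X * h) := by rw [e2]; ring
  rcases le_total (X * h) (Y * g) with hl | hl
  · refine le_antisymm hl ?_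
    rw [f1]; nth_rw 1 [f2]; gcongr
  · refine le_antisymm ?_ hl
    rw [f2]; nth_rw 1 [f1]; gcongr

/-- product of Green functions -/
noncomputable def FF (p : U → U → ℝ≥0∞) : Finset U → List U → ℝ≥0∞
  | _, [] => 1
  | D, a :: t => Gd p D a * FF p (insert a D) t

lemma FF_append (p : U → U → ℝ≥0∞) : ∀ (s : List U) (D : Finset U) (t : List U),
    FF p D (s ++ t) = FF p D s * FF p (D ∪ s.toFinset) t
  | [], D, t => by simp [FF]
  | a :: s, D, t => by
    simp only [List.cons_append, FF, FF_append p s, List.toFinset_cons, Finset.insert_union,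
      Finset.union_insert, mul_assoc]

lemma FF_perm (p : U → U → ℝ≥0∞) {s t : List U} (h : s.Perm t) :
    ∀ D : Finset U, s.Nodup → av D s → FF p D s = FF p D t := by
  induction h with
  | nil => intros; rfl
  | cons a h ih =>
    intro D hn hd
    rw [List.nodup_cons] at hn
    rw [av_cons] at hd
    rw [FF, FF, ih _ hn.2 ((av_insert _ _ _).2 ⟨hn.1, hd.2⟩)]
  | swap a b l =>
    intro D hn hd
    simp only [av_cons] at hd
    simp only [FF]
    rw [← mul_assoc, ← mul_assoc, Gd_swap p D _ _ hd.1 hd.2.1, Finset.insert_comm]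
  | trans h1 h2 ih1 ih2 =>
    intro D hn hd
    rw [ih1 D hn hd, ih2 D (h1.nodup_iff.1 hn) (fun x hx => hd x (h1.mem_iff.2 hx))]
lemma tsum_head (a : U) (f : List U → ℝ≥0∞) (h : ∀ c m, c ≠ a → f (c :: m) = 0) :
    ∑' s, f s = f [] + ∑' m, f (a :: m) := by
  rw [tsum_congr fun l => iv_split (l = []) (f l), ENNReal.tsum_add, tsum_iv_single, add_comm]
  congr 1
  have := tsum_reindex (fun m : List U => a :: m) (fun _ => True) (fun l => ∃ m, l = a :: m) f
    (by simp) (by rintro k ⟨m, rfl⟩; simp) (by simp)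
  simp only [iv_true, one_mul] at this
  rw [this]
  refine tsum_congr fun l => ?_
  rcases l with _ | ⟨c, m⟩
  · simp [iv]
  · by_cases hc : c = a
    · simp [iv, hc]
    · simp [h c m hc]

lemma drop_notMem (a : U) (l : List U) (h : a ∉ l) : dropToLastOcc a l = l := by
  unfold dropToLastOcc
  rw [List.takeWhile_eq_self_iff.2, List.reverse_reverse]
  intro x hx
  simp only [decide_eq_true_eq]
  rintro rfl
  exact h (List.mem_reverse.1 hx)

lemma drop_mid (a : U) (m l : List U) (h : a ∉ l) : dropToLastOcc a (m ++ a :: l) = l := by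
  unfold dropToLastOcc
  rw [List.reverse_append, List.reverse_cons, List.append_assoc,
    List.takeWhile_append_of_pos]
  · simp
  · intro x hx
    simp only [decide_eq_true_eq]
    rintro rfl
    exact h (List.mem_reverse.1 hx)

lemma PLE_nil' (S : Finset U) : PLE S [] = [] := by rw [PLE]
lemma PLE_single (S : Finset U) (a : U) : PLE S [a] = [a] := by rw [PLE]; simp
lemma PLE_notMem (S : Finset U) (a : U) (l : List U) (ha : a ∉ S) (hl : l ≠ []) :
    PLE S (a :: l) = a :: PLE S l := by rw [PLE]; simp [ha, hl]
lemma PLE_mem1 (S : Finset U) (a : U) (l : List U) (ha : a ∈ S) (hal : a ∉ l) (hl : l ≠ []) :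
    PLE S (a :: l) = a :: PLE S l := by
  rw [PLE, if_pos ha, if_neg, drop_notMem a l hal]
  rw [List.getLast_cons hl]
  intro h; apply hal; nth_rw 1 [h]; exact List.getLast_mem hl
lemma PLE_mem2 (S : Finset U) (a : U) (m l : List U) (ha : a ∈ S) (hal : a ∉ l) (hl : l ≠ []) :
    PLE S (a :: (m ++ a :: l)) = a :: PLE S l := by
  rw [PLE, if_pos ha, if_neg, drop_mid a m l hal]
  rw [List.getLast_cons (by simp), List.getLast_append_of_ne_nil _ (by simp), List.getLast_cons hl]
  intro h; apply hal; nth_rw 1 [h]; exact List.getLast_mem hl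
lemma PLE_mem3 (S : Finset U) (a : U) (m : List U) (ha : a ∈ S) :
    PLE S (a :: (m ++ [a])) = [a] := by
  rw [PLE, if_pos ha, if_pos]
  simp

theorem PLE_ind (S : Finset U) {C : List U → Prop} (nil : C []) (single : ∀ a, C [a])
    (notmem : ∀ a l, a ∉ S → l ≠ [] → C l → C (a :: l))
    (mem1 : ∀ a l, a ∈ S → a ∉ l → l ≠ [] → C l → C (a :: l))
    (mem2 : ∀ a m l, a ∈ S → a ∉ l → l ≠ [] → C l → C (a :: (m ++ a :: l)))
    (mem3 : ∀ a m, a ∈ S → C (a :: (m ++ [a]))) : ∀ l, C l := by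
  intro l
  induction hn : l.length using Nat.strong_induction_on generalizing l with
  | _ n ih =>
    rcases l with _ | ⟨a, l⟩
    · exact nil
    by_cases hl : l = []
    · subst hl; exact single a
    have IH : ∀ l', l'.length ≤ l.length → C l' := fun l' h =>
      ih _ (by rw [← hn]; simp; omega) l' rfl
    by_cases ha : a ∈ S
    · by_cases hal : a ∈ l
      · obtain ⟨s, t, rfl, ht⟩ := last_split a l hal
        by_cases htn : t = []
        · subst htn; exact mem3 a s ha
        · exact mem2 a s t ha ht htn (IH t (by simp; omega))
      · exact mem1 a l ha hal hl (IH l le_rfl)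
    · exact notmem a l ha hl (IH l le_rfl)

lemma PLE_head (S : Finset U) : ∀ l, (PLE S l).head? = l.head? := by
  refine PLE_ind S ?_ ?_ ?_ ?_ ?_ ?_
  · rw [PLE_nil']
  · intro a; rw [PLE_single]
  · intro a l h1 h2 _; rw [PLE_notMem S a l h1 h2]; rfl
  · intro a l h1 h2 h3 _; rw [PLE_mem1 S a l h1 h2 h3]; rfl
  · intro a m l h1 h2 h3 _; rw [PLE_mem2 S a m l h1 h2 h3]; rfl
  · intro a m h1; rw [PLE_mem3 S a m h1]; rfl

lemma PLE_eq_nil (S : Finset U) (l : List U) : PLE S l = [] ↔ l = [] := by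
  rw [← List.head?_eq_none_iff, PLE_head, List.head?_eq_none_iff]

lemma getLast?_cons_ne (a : U) (l : List U) (h : l ≠ []) : (a :: l).getLast? = l.getLast? := by
  rcases l with _ | ⟨b, l⟩
  · exact absurd rfl h
  · simp [List.getLast?_cons_cons]

lemma getLast?_app (s : List U) (a : U) (l : List U) :
    (s ++ a :: l).getLast? = (a :: l).getLast? := by
  rw [List.getLast?_append_of_ne_nil _ (by simp)]

lemma PLE_last (S : Finset U) : ∀ l, (PLE S l).getLast? = l.getLast? := by
  have key : ∀ l, l ≠ [] → PLE S l ≠ [] := fun l h => by rwa [Ne, PLE_eq_nil]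
  refine PLE_ind S ?_ ?_ ?_ ?_ ?_ ?_
  · rw [PLE_nil']
  · intro a; rw [PLE_single]
  · intro a l h1 h2 h
    rw [PLE_notMem S a l h1 h2, getLast?_cons_ne _ _ h2, getLast?_cons_ne _ _ (key l h2), h]
  · intro a l h1 h2 h3 h
    rw [PLE_mem1 S a l h1 h2 h3, getLast?_cons_ne _ _ h3, getLast?_cons_ne _ _ (key l h3), h]
  · intro a m l h1 h2 h3 h
    rw [PLE_mem2 S a m l h1 h2 h3, getLast?_cons_ne _ _ (key l h3), h, getLast?_cons_ne _ _ (by simp),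
      getLast?_app, getLast?_cons_ne _ _ h3]
  · intro a m h1; rw [PLE_mem3 S a m h1, getLast?_cons_ne a (m ++ [a]) (by simp), getLast?_app]

lemma PLE_eq_single (S : Finset U) (y : U) (hy : y ∉ S) (l : List U) :
    PLE S l = [y] ↔ l = [y] := by
  constructor
  · intro h
    have hh : l.head? = some y := by rw [← PLE_head S, h]; rfl
    rcases l with _ | ⟨c, l⟩
    · simp at hh
    have : c = y := by simpa using hh
    subst this
    by_cases hl : l = []
    · rw [hl]
    · rw [PLE_notMem S c l hy hl] at h
      simp [PLE_eq_nil, hl] at h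
  · rintro rfl; exact PLE_single S y

/-- first-step weight -/
noncomputable def st (p : U → U → ℝ≥0∞) (a : U) (l : List U) : ℝ≥0∞ := l.head?.elim 1 (p a)

lemma wt_cons (p : U → U → ℝ≥0∞) (a : U) (l : List U) : wt p (a :: l) = st p a l * wt p l := by
  rcases l with _ | ⟨b, l⟩ <;> simp [wt, st]

lemma st_PLE (p : U → U → ℝ≥0∞) (S : Finset U) (a : U) (l : List U) :
    st p a (PLE S l) = st p a l := by
  unfold st; rw [PLE_head]

/-- the points of S along the path -/
def fl (S : Finset U) (u : List U) : List U := u.filter (fun z => z ∈ S)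

lemma fl_cons_mem (S : Finset U) (a : U) (u : List U) (h : a ∈ S) :
    fl S (a :: u) = a :: fl S u := by simp [fl, h]
lemma fl_cons_notMem (S : Finset U) (a : U) (u : List U) (h : a ∉ S) :
    fl S (a :: u) = fl S u := by simp [fl, h]
lemma fl_append (S : Finset U) (s t : List U) : fl S (s ++ t) = fl S s ++ fl S t := by simp [fl]
lemma mem_fl (S : Finset U) (a : U) (u : List U) : a ∈ fl S u ↔ a ∈ u ∧ a ∈ S := by simp [fl]

lemma push (p : U → U → ℝ≥0∞) (S : Finset U) (u : List U) : ∀ D : Finset U, u ≠ [] →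
    (∀ z, u.getLast? = some z → z ∉ S) →
    ∑' l, iv (PLE S l = u) * (iv (av D l) * wt p l) =
      iv (av D u) * (iv (fl S u).Nodup * (wt p u * FF p D (fl S u))) := by
  induction u with
  | nil => intro D h; exact absurd rfl h
  | cons a u ih =>
    intro D _ hlast
    by_cases hu : u = []
    · subst hu
      have ha : a ∉ S := hlast a rfl
      rw [tsum_congr fun l => by rw [iv_congr (PLE_eq_single S a ha l)], tsum_iv_single]
      simp [fl, ha, FF, iv_true]
    rw [getLast?_cons_ne a u hu] at hlast
    by_cases ha : a ∈ S
    · have ih' := ih (insert a D) hu hlast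
      rw [tsum_last a]
      have z1 : ∑' l, iv (a ∉ l) * (iv (PLE S l = a :: u) * (iv (av D l) * wt p l)) = 0 := by
        rw [ENNReal.tsum_eq_zero]
        intro l
        by_cases h : PLE S l = a :: u
        · have hh : l.head? = some a := by rw [← PLE_head S, h]; rfl
          have : a ∈ l := List.mem_of_head? hh
          rw [iv_false (not_not.2 this), zero_mul]
        · rw [iv_false h]; simp
      rw [z1, zero_add, ENNReal.tsum_comm]
      have z2 : ∀ t, ∑' s, iv (a ∉ t) * (iv (PLE S (s ++ a :: t) = a :: u) *
          (iv (av D (s ++ a :: t)) * wt p (s ++ a :: t))) =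
          (iv (a ∉ D) * (Gd p D a * st p a u)) *
            (iv (PLE S t = u) * (iv (av (insert a D) t) * wt p t)) := by
        intro t
        rw [ENNReal.tsum_mul_left, iv_congr (av_insert D a t), iv_and]
        by_cases hat : a ∉ t
        swap
        · rw [iv_false hat]; simp
        rw [iv_true hat, one_mul, one_mul]
        rw [tsum_head a]
        swap
        · intro c m hc
          rw [iv_false, zero_mul]
          intro h
          have hh := PLE_head S (c :: m ++ a :: t)
          rw [h] at hh
          simp at hh
          exact hc hh.symm
        by_cases ht : t = []
        · subst ht
          have e : ∀ m : List U, PLE S (a :: m ++ [a]) = [a] := fun m => PLE_mem3 S a m ha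
          have hu' : ¬ ([a] = a :: u) := by simpa using Ne.symm hu
          have hu'' : ¬ (([] : List U) = u) := Ne.symm hu
          simp only [e, List.nil_append, PLE_single, PLE_nil', iv_false hu', iv_false hu'']
          simp
        have e1 : PLE S ([] ++ a :: t) = a :: PLE S t := PLE_mem1 S a t ha hat ht
        have e2 : ∀ m : List U, PLE S (a :: m ++ a :: t) = a :: PLE S t :=
          fun m => PLE_mem2 S a m t ha hat ht
        simp only [e1, e2, List.cons.injEq, true_and]
        by_cases hP : PLE S t = u
        swap
        · simp [iv_false hP]
        have hst : st p a t = st p a u := by rw [← hP, st_PLE]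
        simp only [iv_true hP, one_mul]
        have e3 : ∀ m : List U, iv (av D (a :: m ++ a :: t)) * wt p (a :: m ++ a :: t) =
            (iv (a ∉ D) * iv (av D t) * st p a u * wt p t) *
              (iv (av D m) * wt p (a :: (m ++ [a]))) := by
          intro m
          have : av D (a :: m ++ a :: t) ↔ (a ∉ D ∧ av D m ∧ av D t) := by
            simp; tauto
          rw [iv_congr this, iv_and, iv_and, List.cons_append, wt_mid, wt_cons p a t, hst]
          ring
        rw [tsum_congr e3, ENNReal.tsum_mul_left]
        change _ + _ * K p D a a = _
        rw [List.nil_append, iv_congr (av_cons D a t), iv_and, wt_cons p a t, hst, Gd]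
        ring
      rw [tsum_congr z2, ENNReal.tsum_mul_left, ih', fl_cons_mem S a u ha, FF, wt_cons,
        iv_congr (av_cons D a u), iv_and, iv_congr List.nodup_cons, iv_and,
        iv_congr (av_insert D a u), iv_and]
      have : a ∉ fl S u ↔ a ∉ u := by rw [mem_fl]; tauto
      rw [iv_congr this]
      ring
    · have ih' := ih D hu hlast
      rw [tsum_head a]
      swap
      · intro c m hc
        rw [iv_false, zero_mul]
        intro h
        have hh := PLE_head S (c :: m)
        rw [h] at hh
        simp at hh
        exact hc hh.symm
      rw [PLE_nil', iv_false (by simp), zero_mul, zero_add]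
      have z : ∀ m, iv (PLE S (a :: m) = a :: u) * (iv (av D (a :: m)) * wt p (a :: m)) =
          (iv (a ∉ D) * st p a u) * (iv (PLE S m = u) * (iv (av D m) * wt p m)) := by
        intro m
        by_cases hm : m = []
        · subst hm
          have hu' : ¬ ([a] = a :: u) := by simpa using Ne.symm hu
          have hu'' : ¬ (([] : List U) = u) := Ne.symm hu
          rw [PLE_single, PLE_nil', iv_false hu', iv_false hu'']
          simp
        rw [PLE_notMem S a m ha hm]
        simp only [List.cons.injEq, true_and]
        by_cases hP : PLE S m = u
        swap
        · simp [iv_false hP]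
        have hst : st p a m = st p a u := by rw [← hP, st_PLE]
        rw [iv_congr (av_cons D a m), iv_and, wt_cons, hst]
        ring
      rw [tsum_congr z, ENNReal.tsum_mul_left, ih', fl_cons_notMem S a u ha, wt_cons,
        iv_congr (av_cons D a u), iv_and]
      ring
lemma PLE_id (S : Finset U) (l : List U) (hn : (fl S l).Nodup)
    (hl : ∀ z, l.getLast? = some z → z ∉ S) : PLE S l = l := by
  induction l with
  | nil => exact PLE_nil' S
  | cons a l ih =>
    by_cases h : l = []
    · subst h; exact PLE_single S a
    rw [getLast?_cons_ne a l h] at hl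
    by_cases ha : a ∈ S
    · rw [fl_cons_mem S a l ha, List.nodup_cons, mem_fl] at hn
      rw [PLE_mem1 S a l ha (fun h => hn.1 ⟨h, ha⟩) h, ih hn.2 hl]
    · rw [fl_cons_notMem S a l ha] at hn
      rw [PLE_notMem S a l ha h, ih hn hl]

lemma fl_insert_notMem (S : Finset U) (v : U) (l : List U) (h : v ∉ l) :
    fl (insert v S) l = fl S l := by
  unfold fl
  apply List.filter_congr
  intro x hx
  have : x ≠ v := fun e => h (e ▸ hx)
  simp [this]

lemma PLE_loop (S : Finset U) (v : U) (s m t : List U) (hvS : v ∉ S) (hs : v ∉ s) (ht : v ∉ t)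
    (htn : t ≠ []) (hn : (fl S (s ++ v :: (m ++ v :: t))).Nodup)
    (hl : ∀ z, t.getLast? = some z → z ∉ S) :
    PLE (insert v S) (s ++ v :: (m ++ v :: t)) = s ++ v :: t := by
  induction s with
  | nil =>
    rw [List.nil_append, PLE_mem2 _ _ _ _ (Finset.mem_insert_self v S) ht htn, PLE_id]
    · rfl
    · rw [fl_insert_notMem S v t ht]
      rw [List.nil_append, fl_cons_notMem S v _ hvS, fl_append, fl_cons_notMem S v _ hvS] at hn
      exact (List.nodup_append.1 hn).2.1
    · intro z hz
      rw [Finset.mem_insert, not_or]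
      refine ⟨?_, hl z hz⟩
      rintro rfl
      exact ht (List.mem_of_getLast? hz)
  | cons c s ih =>
    simp only [List.mem_cons, not_or] at hs
    rw [List.cons_append] at hn ⊢
    by_cases hc : c ∈ S
    · rw [fl_cons_mem S c _ hc, List.nodup_cons, mem_fl] at hn
      rw [PLE_mem1 _ _ _ (Finset.mem_insert_of_mem hc) (fun h => hn.1 ⟨h, hc⟩) (by simp),
        ih hs.2 hn.2]
      rfl
    · rw [fl_cons_notMem S c _ hc] at hn
      rw [PLE_notMem _ _ _ (by simp [hc, Ne.symm hs.1]) (by simp), ih hs.2 hn]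
      rfl

lemma PLE_sdiff (S A : Finset U) : ∀ l : List U, (∀ x ∈ l.dropLast, x ∉ A) →
    PLE S l = PLE (S \ A) l := by
  refine PLE_ind S ?_ ?_ ?_ ?_ ?_ ?_
  · intro _; rw [PLE_nil', PLE_nil']
  · intro a _; rw [PLE_single, PLE_single]
  · intro a l h1 h2 h h3
    rw [List.dropLast_cons_of_ne_nil h2] at h3
    rw [PLE_notMem _ _ _ h1 h2, PLE_notMem _ _ _ (by simp [h1]) h2,
      h (fun x hx => h3 x (List.mem_cons_of_mem _ hx))]
  · intro a l h0 h1 h2 h h3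
    rw [List.dropLast_cons_of_ne_nil h2] at h3
    have ha : a ∉ A := h3 a (by simp)
    rw [PLE_mem1 _ _ _ h0 h1 h2, PLE_mem1 _ _ _ (by simp [h0, ha]) h1 h2,
      h (fun x hx => h3 x (List.mem_cons_of_mem _ hx))]
  · intro a m l h0 h1 h2 h h3
    rw [List.dropLast_cons_of_ne_nil (by simp), List.dropLast_append_of_ne_nil (by simp),
      List.dropLast_cons_of_ne_nil h2] at h3
    have ha : a ∉ A := h3 a (by simp)
    rw [PLE_mem2 _ _ _ _ h0 h1 h2, PLE_mem2 _ _ _ _ (by simp [h0, ha]) h1 h2,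
      h (fun x hx => h3 x (by simp [hx]))]
  · intro a m h0 h3
    rw [List.dropLast_cons_of_ne_nil (by simp)] at h3
    have ha : a ∉ A := h3 a (by simp)
    rw [PLE_mem3 _ _ _ h0, PLE_mem3 _ _ _ (by simp [h0, ha])]

lemma wt_supp (p : U → U → ℝ≥0∞) (A : Finset U) (hp : ∀ a ∈ A, ∀ b, p a b = 0) : ∀ l : List U,
    wt p l ≠ 0 → ∀ x ∈ l.dropLast, x ∉ A
  | [], _ => by simp
  | [a], _ => by simp
  | a :: b :: l, h => by
    rw [wt] at h
    have h1 := left_ne_zero_of_mul h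
    have h2 := wt_supp p A hp (b :: l) (right_ne_zero_of_mul h)
    intro x hx
    rw [List.dropLast_cons_of_ne_nil (by simp), List.mem_cons] at hx
    rcases hx with rfl | hx
    · intro hA; exact h1 (hp _ hA _)
    · exact h2 x hx

lemma loop_form (v : U) (l : List U) : (∃ m, l = v :: (m ++ [v])) ↔
    (l.head? = some v ∧ l.getLast? = some v ∧ l ≠ [v]) := by
  constructor
  · rintro ⟨m, rfl⟩
    refine ⟨rfl, ?_, by simp⟩
    rw [getLast?_cons_ne _ _ (by simp), getLast?_app]; rfl
  · rintro ⟨h1, h2, h3⟩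
    rcases l with _ | ⟨c, l⟩
    · simp at h1
    have : c = v := by simpa using h1
    subst this
    have hl : l ≠ [] := by rintro rfl; exact h3 rfl
    rw [getLast?_cons_ne _ _ hl, List.getLast?_eq_some_iff] at h2
    obtain ⟨m, rfl⟩ := h2
    exact ⟨m, rfl⟩

lemma K_loop (p : U → U → ℝ≥0∞) (S D : Finset U) (v : U) (hS : v ∉ S) (hD : v ∉ D) :
    K p D v v = ∑' m, iv (av D m) *
      (iv (fl S m).Nodup * (wt p (v :: (m ++ [v])) * FF p D (fl S m))) := by
  have inj : ∀ m m' : List U, v :: (m ++ [v]) = v :: (m' ++ [v]) → m = m' := by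
    intro m m' h; simpa using h
  have hR : ∀ f : List U → ℝ≥0∞, ∑' m, f (v :: (m ++ [v])) =
      ∑' l, iv (∃ m, l = v :: (m ++ [v])) * f l := by
    intro f
    rw [← tsum_reindex (fun m : List U => v :: (m ++ [v])) (fun _ => True) _ f
      (fun i _ => ⟨i, rfl⟩) (by rintro k ⟨m, rfl⟩; exact ⟨m, trivial, rfl⟩)
      (fun i j _ _ h => inj i j h)]
    simp [iv_true]
  have e1 : K p D v v = ∑' m : List U, (fun l => iv (av D l) * wt p l) (v :: (m ++ [v])) := by
    refine tsum_congr fun m => ?_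
    have : av D (v :: (m ++ [v])) ↔ av D m := by simp [hD]
    simp only [iv_congr this]
  have e2 : ∀ m : List U, iv (av D m) *
      (iv (fl S m).Nodup * (wt p (v :: (m ++ [v])) * FF p D (fl S m))) =
      (fun u => iv (av D u) * (iv (fl S u).Nodup * (wt p u * FF p D (fl S u))))
        (v :: (m ++ [v])) := by
    intro m
    have h1 : av D (v :: (m ++ [v])) ↔ av D m := by simp [hD]
    have h2 : fl S (v :: (m ++ [v])) = fl S m := by simp [fl, hS]
    simp only [iv_congr h1, h2]
  rw [e1, tsum_congr e2, hR (fun l => iv (av D l) * wt p l),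
    hR (fun u => iv (av D u) * (iv (fl S u).Nodup * (wt p u * FF p D (fl S u))))]
  have e3 : ∀ u : List U, iv (∃ m, u = v :: (m ++ [v])) *
      (iv (av D u) * (iv (fl S u).Nodup * (wt p u * FF p D (fl S u)))) =
      ∑' l, iv (PLE S l = u) * (iv (∃ m, u = v :: (m ++ [v])) * (iv (av D l) * wt p l)) := by
    intro u
    rw [iv_mul_congr (y := ∑' l, iv (PLE S l = u) * (iv (av D l) * wt p l)),
      ← ENNReal.tsum_mul_left]
    · refine tsum_congr fun l => ?_
      ring
    · intro h
      rw [push p S u D]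
      · rintro rfl; simp at h
      · intro z hz
        rw [((loop_form v u).1 h).2.1] at hz
        cases hz; exact hS
  rw [tsum_congr e3, ENNReal.tsum_comm]
  refine tsum_congr fun l => ?_
  rw [tsum_iv_single' (PLE S l) (fun u => iv (∃ m, u = v :: (m ++ [v])) * (iv (av D l) * wt p l))]
  congr 1
  apply iv_congr
  rw [loop_form, loop_form, PLE_head, PLE_last, Ne, Ne, PLE_eq_single S v hS]

/-- support of the law -/
def Nn (A : Finset U) (x : U) (S : Finset U) (u : List U) : Prop :=
  u.head? = some x ∧ (∃ z ∈ A, u.getLast? = some z) ∧ (fl S u).Nodup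

/-- the law of the partial loop erasure -/
noncomputable def rho (p : U → U → ℝ≥0∞) (A : Finset U) (x : U) (S : Finset U) (u : List U) :
    ℝ≥0∞ := iv (Nn A x S u) * (wt p u * FF p ∅ (fl S u))

lemma rho_empty (p : U → U → ℝ≥0∞) (A : Finset U) (x : U) (u : List U) :
    rho p A x ∅ u = iv (u.head? = some x ∧ (∃ z ∈ A, u.getLast? = some z)) * wt p u := by
  have : fl ∅ u = [] := by simp [fl]
  simp [rho, Nn, this, FF]

lemma claimA (p : U → U → ℝ≥0∞) (A : Finset U) (x : U) (S : Finset U) (hSA : ∀ z ∈ A, z ∉ S)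
    (u : List U) : ∑' l, iv (PLE S l = u) * rho p A x ∅ l = rho p A x S u := by
  have e : ∀ l, iv (PLE S l = u) * rho p A x ∅ l =
      iv (u.head? = some x ∧ (∃ z ∈ A, u.getLast? = some z)) *
        (iv (PLE S l = u) * (iv (av ∅ l) * wt p l)) := by
    intro l
    rw [rho_empty, iv_true (p := av ∅ l) (by simp [av])]
    by_cases h : PLE S l = u
    · rw [← h, PLE_head, PLE_last]; ring
    · simp [iv_false h]
  rw [tsum_congr e, ENNReal.tsum_mul_left, rho]
  have : Nn A x S u ↔ (u.head? = some x ∧ (∃ z ∈ A, u.getLast? = some z)) ∧ (fl S u).Nodup := by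
    unfold Nn; tauto
  rw [iv_congr this, iv_and _ (fl S u).Nodup, mul_assoc]
  apply iv_mul_congr
  rintro ⟨h1, z, hz, h2⟩
  rw [push p S u ∅, iv_true (by simp [av]), one_mul]
  · rintro rfl; simp at h1
  · intro z' hz'
    rw [h2] at hz'; cases hz'; exact hSA _ hz

lemma tsum_both (v : U) (f : List U → ℝ≥0∞) :
    ∑' l, f l = ∑' l, iv (v ∉ l) * f l + ∑' s, ∑' t, iv (v ∉ s) * (iv (v ∉ t) *
      (f (s ++ v :: t) + ∑' m, f (s ++ v :: (m ++ v :: t)))) := by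
  rw [tsum_first v]
  congr 1
  refine tsum_congr fun s => ?_
  rw [ENNReal.tsum_mul_left, ENNReal.tsum_mul_left, tsum_last v, ENNReal.tsum_comm,
    ← ENNReal.tsum_add]
  congr 1
  refine tsum_congr fun t => ?_
  rw [ENNReal.tsum_mul_left]
  ring

lemma rho_step (p : U → U → ℝ≥0∞) (A : Finset U) (x : U) (S : Finset U) (v : U)
    (hv : v ∉ S) (s t : List U) (hs : v ∉ s) (ht : v ∉ t)
    (hN : Nn A x S (s ++ v :: t)) :
    rho p A x S (s ++ v :: t) + ∑' m, rho p A x S (s ++ v :: (m ++ v :: t)) =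
      rho p A x (insert v S) (s ++ v :: t) := by
  obtain ⟨h1, h2, h3⟩ := hN
  have f1 : fl S (s ++ v :: t) = fl S s ++ fl S t := by
    rw [fl_append, fl_cons_notMem S v t hv]
  have f2 : ∀ m, fl S (s ++ v :: (m ++ v :: t)) = fl S s ++ (fl S m ++ fl S t) := by
    intro m
    rw [fl_append, fl_cons_notMem S v _ hv, fl_append, fl_cons_notMem S v _ hv]
  have f3 : fl (insert v S) (s ++ v :: t) = fl S s ++ v :: fl S t := by
    rw [fl_append, fl_cons_mem _ v _ (Finset.mem_insert_self v S), fl_insert_notMem S v s hs,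
      fl_insert_notMem S v t ht]
  rw [f1] at h3
  set d := fl S s ++ fl S t with hd
  have hvd : v ∉ d := by
    rw [hd, List.mem_append, mem_fl, mem_fl]; tauto
  set D := d.toFinset with hD
  have hvD : v ∉ D := by rwa [hD, List.mem_toFinset]
  have n3 : (fl S s ++ v :: fl S t).Nodup :=
    (List.perm_middle.nodup_iff).2 (List.nodup_cons.2 ⟨hvd, h3⟩)
  have g3 : FF p ∅ (fl S s ++ v :: fl S t) = FF p ∅ d * Gd p D v := by
    have hpm : (fl S s ++ v :: fl S t).Perm (d ++ [v]) :=
      List.perm_middle.trans (List.perm_append_comm (l₁ := [v]) (l₂ := d))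
    rw [FF_perm p hpm ∅ n3 (by simp [av]), FF_append]
    simp [FF, hD]
  have pm : ∀ m, (fl S s ++ (fl S m ++ fl S t)).Perm (d ++ fl S m) := by
    intro m
    rw [hd, List.append_assoc]
    exact List.Perm.append_left _ List.perm_append_comm
  have n2 : ∀ m, (fl S s ++ (fl S m ++ fl S t)).Nodup ↔ av D m ∧ (fl S m).Nodup := by
    intro m
    rw [(pm m).nodup_iff, List.nodup_append']
    constructor
    · rintro ⟨_, h, hh⟩
      refine ⟨fun y hy hyD => ?_, h⟩
      rw [hD, List.mem_toFinset] at hyD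
      refine hh hyD ?_
      rw [mem_fl]
      refine ⟨hy, ?_⟩
      rw [hd, List.mem_append, mem_fl, mem_fl] at hyD
      tauto
    · rintro ⟨h, hh⟩
      refine ⟨h3, hh, fun y hy hym => ?_⟩
      rw [mem_fl] at hym
      exact h y hym.1 (by rwa [hD, List.mem_toFinset])
  have R1 : rho p A x S (s ++ v :: t) = wt p (s ++ [v]) * wt p (v :: t) * FF p ∅ d := by
    rw [rho, iv_true ⟨h1, h2, by rwa [f1]⟩, one_mul, f1, wt_append]
  have R3 : rho p A x (insert v S) (s ++ v :: t) =
      wt p (s ++ [v]) * wt p (v :: t) * (FF p ∅ d * Gd p D v) := by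
    rw [rho, iv_true ⟨h1, h2, by rwa [f3]⟩, one_mul, f3, wt_append, g3]
  have R2 : ∀ m, rho p A x S (s ++ v :: (m ++ v :: t)) =
      (wt p (s ++ [v]) * wt p (v :: t) * FF p ∅ d) * (iv (av D m) *
      (iv (fl S m).Nodup * (wt p (v :: (m ++ [v])) * FF p D (fl S m)))) := by
    intro m
    have : Nn A x S (s ++ v :: (m ++ v :: t)) ↔ av D m ∧ (fl S m).Nodup := by
      rw [← n2 m]
      unfold Nn
      rw [f2]
      have hh : (s ++ v :: (m ++ v :: t)).head? = some x := by
        rw [← h1]; cases s <;> rfl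
      have hl : (s ++ v :: (m ++ v :: t)).getLast? = (s ++ v :: t).getLast? := by
        rw [getLast?_app, getLast?_app, getLast?_cons_ne _ _ (by simp), getLast?_app]
      rw [hl]
      tauto
    rw [rho, iv_congr this]
    have : iv (av D m ∧ (fl S m).Nodup) * (wt p (s ++ v :: (m ++ v :: t)) *
        FF p ∅ (fl S (s ++ v :: (m ++ v :: t)))) = iv (av D m ∧ (fl S m).Nodup) *
        ((wt p (s ++ [v]) * (wt p (v :: (m ++ [v])) * wt p (v :: t))) *
          (FF p ∅ d * FF p D (fl S m))) := by
      apply iv_mul_congr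
      intro h
      rw [wt_append, wt_mid, f2, FF_perm p (pm m) ∅ ((n2 m).2 h) (by simp [av]), FF_append,
        Finset.empty_union]
    rw [this, iv_and]
    ring
  rw [tsum_congr R2, ENNReal.tsum_mul_left, ← K_loop p S D v hv hvD, R1, R3, Gd]
  ring

lemma claimB (p : U → U → ℝ≥0∞) (A : Finset U) (x : U) (S : Finset U) (v : U)
    (hSA : ∀ z ∈ A, z ∉ S) (hv : v ∉ S) (hvA : v ∉ A) (u : List U) :
    ∑' l, iv (PLE (insert v S) l = u) * rho p A x S l = rho p A x (insert v S) u := by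
  have hSA' : ∀ z ∈ A, z ∉ insert v S := by
    intro z hz
    rw [Finset.mem_insert, not_or]
    exact ⟨fun e => hvA (e ▸ hz), hSA z hz⟩
  rw [← tsum_iv_single u (fun l => rho p A x (insert v S) l), tsum_both v,
    tsum_both v (fun l => iv (l = u) * rho p A x (insert v S) l)]
  congr 1
  · refine tsum_congr fun l => iv_mul_congr fun hl => ?_
    have e := fl_insert_notMem S v l hl
    unfold rho Nn
    rw [e]
    by_cases h : (l.head? = some x ∧ (∃ z ∈ A, l.getLast? = some z) ∧ (fl S l).Nodup)
    · rw [PLE_id _ l (by rw [e]; exact h.2.2)]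
      intro z' hz'
      obtain ⟨z, hz, hz2⟩ := h.2.1
      rw [hz2] at hz'; cases hz'; exact hSA' _ hz
    · rw [iv_false h]; simp
  · refine tsum_congr fun s => tsum_congr fun t => iv_mul_congr fun hs => iv_mul_congr fun ht => ?_
    have f3 : fl (insert v S) (s ++ v :: t) = fl S s ++ v :: fl S t := by
      rw [fl_append, fl_cons_mem _ v _ (Finset.mem_insert_self v S), fl_insert_notMem S v s hs,
        fl_insert_notMem S v t ht]
    have f1 : fl S (s ++ v :: t) = fl S s ++ fl S t := by
      rw [fl_append, fl_cons_notMem S v t hv]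
    have f2 : ∀ m, fl S (s ++ v :: (m ++ v :: t)) = fl S s ++ (fl S m ++ fl S t) := by
      intro m
      rw [fl_append, fl_cons_notMem S v _ hv, fl_append, fl_cons_notMem S v _ hv]
    have hz : ∀ m, rho p A x (insert v S) (s ++ v :: (m ++ v :: t)) = 0 := by
      intro m
      rw [rho, iv_false, zero_mul]
      rintro ⟨_, _, h⟩
      rw [fl_append, fl_cons_mem _ v _ (Finset.mem_insert_self v S), fl_append,
        fl_cons_mem _ v _ (Finset.mem_insert_self v S)] at h
      have := (List.nodup_append.1 h).2.1
      simp at this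
    simp only [hz, mul_zero, tsum_zero, add_zero]
    by_cases hN : Nn A x S (s ++ v :: t)
    · rw [← rho_step p A x S v hv s t hs ht hN, mul_add, ← ENNReal.tsum_mul_left]
      obtain ⟨h1, ⟨z, hzA, hz2⟩, h3⟩ := hN
      have htn : t ≠ [] := by
        rintro rfl
        rw [getLast?_app] at hz2
        cases hz2; exact hvA hzA
      have hlt : ∀ z', t.getLast? = some z' → z' ∉ S := by
        intro z' hz'
        rw [getLast?_app, getLast?_cons_ne _ _ htn] at hz2
        rw [hz2] at hz'; cases hz'; exact hSA _ hzA
      congr 1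
      · rw [PLE_id]
        · rw [f3]
          refine (List.perm_middle.nodup_iff).2 (List.nodup_cons.2 ⟨?_, by rwa [f1] at h3⟩)
          rw [List.mem_append, mem_fl, mem_fl]; tauto
        · intro z' hz'
          rw [hz2] at hz'; cases hz'; exact hSA' _ hzA
      · refine tsum_congr fun m => ?_
        by_cases hn : (fl S (s ++ v :: (m ++ v :: t))).Nodup
        · rw [PLE_loop S v s m t hv hs ht htn hn hlt]
        · have : rho p A x S (s ++ v :: (m ++ v :: t)) = 0 := by
            rw [rho, iv_false, zero_mul]
            exact fun h => hn h.2.2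
          rw [this]; simp
    · have z1 : rho p A x S (s ++ v :: t) = 0 := by rw [rho, iv_false hN, zero_mul]
      have z2 : ∀ m, rho p A x S (s ++ v :: (m ++ v :: t)) = 0 := by
        intro m
        rw [rho, iv_false, zero_mul]
        rintro ⟨h1, h2, h3⟩
        apply hN
        refine ⟨?_, ?_, ?_⟩
        · rw [← h1]; cases s <;> rfl
        · rw [getLast?_app, getLast?_cons_ne _ _ (by simp), getLast?_app] at h2
          rwa [getLast?_app]
        · rw [f1]; rw [f2] at h3
          exact h3.sublist (List.Sublist.append_left (List.sublist_append_right _ _) _)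
      have z3 : rho p A x (insert v S) (s ++ v :: t) = 0 := by
        rw [rho, iv_false, zero_mul]
        rintro ⟨h1, h2, h3⟩
        refine hN ⟨h1, h2, ?_⟩
        rw [f1]; rw [f3] at h3
        exact h3.sublist (List.Sublist.append_left (List.sublist_cons_self _ _) _)
      simp [z1, z2, z3]

lemma claimB0 (p : U → U → ℝ≥0∞) (A : Finset U) (x : U) (S : Finset U)
    (hSA : ∀ z ∈ A, z ∉ S) (u : List U) :
    ∑' l, iv (PLE S l = u) * rho p A x S l = rho p A x S u := by
  rw [← tsum_iv_single u (fun l => rho p A x S l)]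
  refine tsum_congr fun l => ?_
  by_cases h : Nn A x S l
  · rw [PLE_id _ l h.2.2]
    intro z' hz'
    obtain ⟨z, hz, hz2⟩ := h.2.1
    rw [hz2] at hz'; cases hz'; exact hSA _ hz
  · rw [rho, iv_false h]; simp

lemma rho_sdiff (p : U → U → ℝ≥0∞) (A : Finset U) (hp : ∀ a ∈ A, ∀ b, p a b = 0) (x : U)
    (S T : Finset U) (u l : List U) :
    iv (PLE T l = u) * rho p A x S l = iv (PLE (T \ A) l = u) * rho p A x S l := by
  by_cases h : wt p l = 0
  · rw [rho, h]; simp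
  · rw [PLE_sdiff T A l (wt_supp p A hp l h)]

lemma iter_law [Fintype U] (p : U → U → ℝ≥0∞) (A : Finset U) (hp : ∀ a ∈ A, ∀ b, p a b = 0)
    (x : U) (m : ℕ) (W : ℕ → Finset U)
    (hWstep : ∀ j : ℕ, 2 ≤ j → j ≤ m → W (j - 1) ⊆ W j ∧ (W j \ W (j - 1)).card = 1) :
    ∀ k, k + 1 ≤ m → ∀ u, ∑' l, iv (iterPLE W (k + 1) l = u) * rho p A x ∅ l =
      rho p A x (W (k + 1) \ A) u := by
  intro k
  induction k with
  | zero =>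
    intro _ u
    simp only [iterPLE]
    rw [tsum_congr fun l => rho_sdiff p A hp x ∅ _ u l, claimA p A x _ (by simp +contextual)]
  | succ k ih =>
    intro hk u
    have e : ∀ l, iv (iterPLE W (k + 1 + 1) l = u) * rho p A x ∅ l =
        ∑' l', iv (PLE (W (k + 1 + 1)) l' = u) * (iv (iterPLE W (k + 1) l = l') * rho p A x ∅ l) := by
      intro l
      have := tsum_iv_single' (iterPLE W (k + 1) l)
        (fun l' => iv (PLE (W (k + 1 + 1)) l' = u) * rho p A x ∅ l)
      rw [iterPLE, ← this]
      exact tsum_congr fun l' => by ring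
    rw [tsum_congr e, ENNReal.tsum_comm]
    have e' : ∀ l', ∑' l, iv (PLE (W (k + 1 + 1)) l' = u) *
        (iv (iterPLE W (k + 1) l = l') * rho p A x ∅ l) =
        iv (PLE (W (k + 1 + 1) \ A) l' = u) * rho p A x (W (k + 1) \ A) l' := by
      intro l'
      rw [ENNReal.tsum_mul_left, ih (by omega), rho_sdiff p A hp]
    rw [tsum_congr e']
    obtain ⟨hsub, hcard⟩ := hWstep (k + 1 + 1) (by omega) hk
    rw [Nat.add_sub_cancel] at hsub hcard
    obtain ⟨v, hv⟩ := Finset.card_eq_one.1 hcard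
    have hmem : ∀ y, y ∈ W (k + 1 + 1) ↔ y = v ∨ y ∈ W (k + 1) := by
      intro y
      have h := Finset.ext_iff.1 hv y
      rw [Finset.mem_sdiff, Finset.mem_singleton] at h
      have := @hsub y
      tauto
    have hvn : v ∉ W (k + 1) := by
      have h := Finset.ext_iff.1 hv v
      simp at h; exact h.2
    by_cases hvA : v ∈ A
    · have : W (k + 1 + 1) \ A = W (k + 1) \ A := by
        ext y
        rw [Finset.mem_sdiff, Finset.mem_sdiff, hmem]
        constructor
        · rintro ⟨rfl | h, h'⟩
          · exact absurd hvA h'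
          · exact ⟨h, h'⟩
        · rintro ⟨h, h'⟩; exact ⟨Or.inr h, h'⟩
      rw [this]
      exact claimB0 p A x _ (by simp +contextual) u
    · have : W (k + 1 + 1) \ A = insert v (W (k + 1) \ A) := by
        ext y
        rw [Finset.mem_sdiff, Finset.mem_insert, Finset.mem_sdiff, hmem]
        constructor
        · tauto
        · rintro (rfl | h)
          · exact ⟨Or.inl rfl, hvA⟩
          · tauto
      rw [this]
      exact claimB p A x _ v (by simp +contextual) (by simp [hvn]) hvA u
lemma wt_range (p : U → U → ℝ≥0∞) (y : ℕ → U) (n : ℕ) :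
    wt p ((List.range (n + 1)).map y) = ∏ i ∈ Finset.Icc 1 n, p (y (i - 1)) (y i) := by
  induction n with
  | zero => simp [wt]
  | succ n ih =>
    rw [Finset.prod_Icc_succ_top (by omega), ← ih, List.range_succ, List.map_append,
      List.range_succ, List.map_append]
    simp only [List.map_cons, List.map_nil, List.append_assoc, List.cons_append, List.nil_append]
    rw [wt_append]
    simp [wt]

lemma list_repr (a : U) (l : List U) : ∃ (y : ℕ → U) (n : ℕ),
    a :: l = (List.range (n + 1)).map y := by
  refine ⟨fun i => (a :: l).getD i a, l.length, ?_⟩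
  apply List.ext_getElem
  · simp
  · intro i h1 h2
    rw [List.getElem_map, List.getElem_range, List.getD_eq_getElem _ _ h1]

lemma range_map_inj (y z : ℕ → U) (n k : ℕ) :
    (List.range (n + 1)).map y = (List.range (k + 1)).map z ↔ n = k ∧ ∀ i ≤ k, y i = z i := by
  constructor
  · intro h
    have hl := congrArg List.length h
    simp at hl
    subst hl
    refine ⟨rfl, fun i hi => ?_⟩
    have := List.map_inj_left.1 h i (by simp; omega)
    exact this
  · rintro ⟨rfl, h⟩
    apply List.map_inj_left.2
    intro i hi
    exact h i (by simp at hi; omega)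

lemma event_eq [Fintype U] (A : Finset U) (y : ℕ → U) (n : ℕ) (h1 : y n ∈ A)
    (h2 : ∀ i < n, y i ∉ A) :
    {ω : ℕ → U | (∃ k, ω k ∈ A) ∧ stoppedPath A ω = (List.range (n + 1)).map y} =
      {ω | ∀ i ≤ n, ω i = y i} := by
  ext ω
  simp only [Set.mem_setOf_eq, stoppedPath, range_map_inj]
  constructor
  · rintro ⟨_, _, h⟩; exact h
  · intro h
    have hn : ω n ∈ A := by rw [h n le_rfl]; exact h1
    refine ⟨⟨n, hn⟩, ?_, h⟩
    apply le_antisymm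
    · exact Nat.sInf_le hn
    · by_contra hlt
      push Not at hlt
      have : ω (entryTimeNat A ω) ∈ A := Nat.sInf_mem (s := {n : ℕ | ω n ∈ A}) ⟨n, hn⟩
      rw [h _ hlt.le] at this
      exact h2 _ hlt this

lemma event_empty [Fintype U] (A : Finset U) (y : ℕ → U) (n : ℕ)
    (h : ¬ (y n ∈ A ∧ ∀ i < n, y i ∉ A)) :
    {ω : ℕ → U | (∃ k, ω k ∈ A) ∧ stoppedPath A ω = (List.range (n + 1)).map y} = ∅ := by
  rw [Set.eq_empty_iff_forall_notMem]
  rintro ω ⟨hk, he⟩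
  simp only [stoppedPath, range_map_inj] at he
  obtain ⟨e, he⟩ := he
  apply h
  have hm : ω (entryTimeNat A ω) ∈ A := Nat.sInf_mem (s := {n : ℕ | ω n ∈ A}) hk
  rw [e, he n le_rfl] at hm
  refine ⟨hm, fun i hi hA => ?_⟩
  rw [← he i hi.le] at hA
  have : entryTimeNat A ω ≤ i := Nat.sInf_le hA
  omega

lemma event_law [Fintype U] [MeasurableSpace U] [MeasurableSingletonClass U]
    (P : U → U → ℝ) (μ : Measure (ℕ → U)) (x : U)
    (hP0 : ∀ a b : U, 0 ≤ P a b)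
    (hlaw : ∀ (n : ℕ) (y : ℕ → U),
      μ {ω | ∀ i ≤ n, ω i = y i} =
        ENNReal.ofReal ((if x = y 0 then (1 : ℝ) else 0) *
          ∏ i ∈ Finset.Icc 1 n, P (y (i - 1)) (y i)))
    (A : Finset U) (l : List U) :
    MeasurableSet {ω : ℕ → U | (∃ k, ω k ∈ A) ∧ stoppedPath A ω = l} ∧
    μ {ω : ℕ → U | (∃ k, ω k ∈ A) ∧ stoppedPath A ω = l} =
      rho (fun a b => if a ∈ A then 0 else ENNReal.ofReal (P a b)) A x ∅ l := by
  rw [rho_empty]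
  rcases l with _ | ⟨a, l⟩
  · have : {ω : ℕ → U | (∃ k, ω k ∈ A) ∧ stoppedPath A ω = []} = ∅ := by
      ext ω; simp [stoppedPath]
    rw [this, iv_false (by simp)]
    simp
  obtain ⟨y, n, e⟩ := list_repr a l
  rw [e]
  have hh : ((List.range (n + 1)).map y).head? = some (y 0) := by
    simp [List.range_succ_eq_map]
  have hl : ((List.range (n + 1)).map y).getLast? = some (y n) := by
    simp [List.range_succ]
  rw [hh, hl, wt_range]
  by_cases hg : y n ∈ A ∧ ∀ i < n, y i ∉ A
  · rw [event_eq A y n hg.1 hg.2]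
    constructor
    · have : {ω : ℕ → U | ∀ i ≤ n, ω i = y i} = ⋂ i ∈ Set.Iic n, (fun ω : ℕ → U => ω i) ⁻¹' {y i} := by
        ext ω; simp
      rw [this]
      exact MeasurableSet.biInter (Set.to_countable _)
        fun i _ => measurable_pi_apply i (measurableSet_singleton _)
    · rw [hlaw]
      have : ∏ i ∈ Finset.Icc 1 n, (if y (i - 1) ∈ A then 0 else ENNReal.ofReal (P (y (i - 1)) (y i)))
          = ENNReal.ofReal (∏ i ∈ Finset.Icc 1 n, P (y (i - 1)) (y i)) := by
        rw [ENNReal.ofReal_prod_of_nonneg (fun i _ => hP0 _ _)]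
        refine Finset.prod_congr rfl fun i hi => ?_
        rw [Finset.mem_Icc] at hi
        rw [if_neg (hg.2 (i - 1) (by omega))]
      rw [this]
      by_cases hx : x = y 0
      · rw [if_pos hx, one_mul, iv_true, one_mul]
        exact ⟨by rw [hx], y n, hg.1, rfl⟩
      · rw [if_neg hx, iv_false]
        · simp
        · rintro ⟨h, _⟩
          exact hx (Option.some.inj h).symm
  · rw [event_empty A y n hg]
    refine ⟨MeasurableSet.empty, ?_⟩
    rw [measure_empty]
    symm
    by_cases hn : y n ∈ A
    · have : ∃ i < n, y i ∈ A := by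
        by_contra hc; push Not at hc; exact hg ⟨hn, hc⟩
      obtain ⟨i, hi, hiA⟩ := this
      rw [Finset.prod_eq_zero (i := i + 1), mul_zero]
      · simp; omega
      · simp [hiA]
    · rw [iv_false, zero_mul]
      rintro ⟨_, z, hz, h⟩
      exact hn (Option.some.inj h ▸ hz)

lemma total_law [Fintype U] [MeasurableSpace U] [MeasurableSingletonClass U]
    (P : U → U → ℝ) (μ : Measure (ℕ → U)) (x : U)
    (hP0 : ∀ a b : U, 0 ≤ P a b)
    (hlaw : ∀ (n : ℕ) (y : ℕ → U),
      μ {ω | ∀ i ≤ n, ω i = y i} =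
        ENNReal.ofReal ((if x = y 0 then (1 : ℝ) else 0) *
          ∏ i ∈ Finset.Icc 1 n, P (y (i - 1)) (y i)))
    (A : Finset U) (f : List U → List U) (w : List U) :
    μ {ω : ℕ → U | (∃ k, ω k ∈ A) ∧ f (stoppedPath A ω) = w} = ∑' l, iv (f l = w) *
      rho (fun a b => if a ∈ A then 0 else ENNReal.ofReal (P a b)) A x ∅ l := by
  have hU : {ω : ℕ → U | (∃ k, ω k ∈ A) ∧ f (stoppedPath A ω) = w} =
      ⋃ l : List U, {ω : ℕ → U | ((∃ k, ω k ∈ A) ∧ stoppedPath A ω = l) ∧ f l = w} := by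
    ext ω
    simp only [Set.mem_setOf_eq, Set.mem_iUnion]
    constructor
    · rintro ⟨h1, h2⟩; exact ⟨_, ⟨h1, rfl⟩, h2⟩
    · rintro ⟨l, ⟨h1, rfl⟩, h2⟩; exact ⟨h1, h2⟩
  have hc : ∀ l, MeasurableSet {ω : ℕ → U | ((∃ k, ω k ∈ A) ∧ stoppedPath A ω = l) ∧ f l = w} ∧
      μ {ω : ℕ → U | ((∃ k, ω k ∈ A) ∧ stoppedPath A ω = l) ∧ f l = w} = iv (f l = w) *
      rho (fun a b => if a ∈ A then 0 else ENNReal.ofReal (P a b)) A x ∅ l := by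
    intro l
    have := event_law P μ x hP0 hlaw A l
    by_cases h : f l = w
    · simpa [h, iv_true] using this
    · simp [h, iv_false]
  rw [hU, measure_iUnion]
  · exact tsum_congr fun l => (hc l).2
  · intro l l' hne
    rw [Function.onFun, Set.disjoint_left]
    rintro ω ⟨⟨_, h1⟩, _⟩ ⟨⟨_, h2⟩, _⟩
    exact hne (h1.symm.trans h2)
  · exact fun l => (hc l).1

end Aux

theorem loop_erasure_eq_refinement_one_point_steps
    {V : Type*} [Fintype V] [DecidableEq V] [Nonempty V]
    [MeasurableSpace V] [MeasurableSingletonClass V]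
    (P : V → V → ℝ) (μ : V → Measure (ℕ → V))
    (hP0 : ∀ a b : V, 0 ≤ P a b) (hP1 : ∀ a : V, ∑ b : V, P a b = 1)
    (hprob : ∀ a : V, IsProbabilityMeasure (μ a))
    (hlaw : ∀ (a : V) (n : ℕ) (y : ℕ → V),
      μ a {ω | ∀ i ≤ n, ω i = y i} =
        ENNReal.ofReal ((if a = y 0 then (1 : ℝ) else 0) *
          ∏ i ∈ Finset.Icc 1 n, P (y (i - 1)) (y i)))
    (m : ℕ) (hm : 1 ≤ m) (W : ℕ → Finset V)
    (hW1 : (W 1).Nonempty)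
    (hWstep : ∀ j : ℕ, 2 ≤ j → j ≤ m → W (j - 1) ⊆ W j ∧ (W j \ W (j - 1)).card = 1)
    (hWm : W m = Finset.univ)
    (A : Finset V) (x : V)
    (hx : μ x {ω | ∃ n : ℕ, ω n ∈ A} = 1) :
    ∀ w : List V,
      μ x {ω | (∃ n : ℕ, ω n ∈ A) ∧ LE (stoppedPath A ω) = w} =
        μ x {ω | (∃ n : ℕ, ω n ∈ A) ∧ iterPLE W m (stoppedPath A ω) = w} := by
  intro w
  set p : V → V → ENNReal := fun a b => if a ∈ A then 0 else ENNReal.ofReal (P a b) with hp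
  have hp0 : ∀ a ∈ A, ∀ b, p a b = 0 := by
    intro a ha b; simp [hp, ha]
  rw [total_law P (μ x) x hP0 (hlaw x) A LE w, total_law P (μ x) x hP0 (hlaw x) A (iterPLE W m) w]
  obtain ⟨k, rfl⟩ : ∃ k, m = k + 1 := ⟨m - 1, by omega⟩
  rw [iter_law p A hp0 x (k + 1) W hWstep k le_rfl w, hWm]
  unfold LE
  rw [tsum_congr fun l => rho_sdiff p A hp0 x ∅ _ w l,
    claimA p A x _ (by simp +contextual)]

end LERW
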